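/- arXiv:1701.07251 — 2 statements merged into one kernel-verified Lean document; each statement's English description precedes it below -/
import Mathlib

section
/- Let G be a descriptive approximately group with approximately identity e, let H be a nonempty subset of G, and suppose Φ*H is a groupoid, i.e. for all a, b ∈ Φ*H, a·b ∈ Φ*H. Then H is a descriptive approximately subgroup of G (i.e. H is itself a descriptive approximately group with respect to the operation of X, with the same approximately identity e) if and only if for every x ∈ H the inverse x⁻¹ of x (an element y ∈ G with x·y = y·x = e) belongs to H. -/
/-- Descriptively upper approximation Φ*A. -/
def upperApprox {X D : Type*} (Φ : X → D) (A : Set X) : Set X := {x | Φ x ∈ Φ '' A}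

/-- `G` is a descriptive approximately group with approximately identity `e`. -/
def ApproxGroup {X D : Type*} (op : X → X → X) (Φ : X → D) (G : Set X) (e : X) : Prop :=
  (∀ x ∈ G, ∀ y ∈ G, op x y ∈ upperApprox Φ G) ∧
  (∀ x ∈ G, ∀ y ∈ G, ∀ z ∈ G, op (op x y) z = op x (op y z)) ∧
  (e ∈ upperApprox Φ G ∧ ∀ x ∈ G, op x e = x ∧ op e x = x) ∧
  (∀ x ∈ G, ∃ y ∈ G, op x y = e ∧ op y x = e)

theorem approx_subgroup_iff_inv_mem {X D : Type*} (op : X → X → X) (Φ : X → D)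
    (G : Set X) (e : X)
    (hG : ApproxGroup op Φ G e)
    (H : Set X) (hHG : H ⊆ G) (hHne : H.Nonempty)
    (hgroupoid : ∀ a ∈ upperApprox Φ H, ∀ b ∈ upperApprox Φ H,
      op a b ∈ upperApprox Φ H) :
    ApproxGroup op Φ H e ↔
      ∀ x ∈ H, ∀ y ∈ G, (op x y = e ∧ op y x = e) → y ∈ H := by
  obtain ⟨-, hassoc, ⟨-, hid⟩, hinv⟩ := hG
  have hsub : H ⊆ upperApprox Φ H := fun x hx => Set.mem_image_of_mem Φ hx
  constructor
  · rintro ⟨-, -, -, hHinv⟩ x hx y hy ⟨-, hyx⟩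
    obtain ⟨z, hz, hxz, -⟩ := hHinv x hx
    have hyz : y = z := by
      rw [← (hid y hy).1, ← hxz, ← hassoc y hy x (hHG hx) z (hHG hz), hyx,
        (hid z (hHG hz)).2]
    exact hyz ▸ hz
  · intro h
    have hHinv : ∀ x ∈ H, ∃ y ∈ H, op x y = e ∧ op y x = e := fun x hx =>
      let ⟨y, hy, hxy⟩ := hinv x (hHG hx)
      ⟨y, h x hx y hy hxy, hxy⟩
    refine ⟨fun x hx y hy => hgroupoid x (hsub hx) y (hsub hy),
      fun x hx y hy z hz => hassoc x (hHG hx) y (hHG hy) z (hHG hz),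
      ⟨?_, fun x hx => hid x (hHG hx)⟩, hHinv⟩
    obtain ⟨x, hx⟩ := hHne
    obtain ⟨y, hy, hxy, -⟩ := hHinv x hx
    exact hxy ▸ hgroupoid x (hsub hx) y (hsub hy)
end

section
/- Let G be a descriptive approximately group with approximately identity e, and let H₁ and H₂ be descriptive approximately subgroups of G such that Φ*H₁ and Φ*H₂ are groupoids (closed under the operation) and (Φ*H₁) ∩ (Φ*H₂) = Φ*(H₁ ∩ H₂). If H₁ ∩ H₂ is nonempty, then H₁ ∩ H₂ is a descriptive approximately subgroup of G. -/
theorem approx_subgroup_inter {X D : Type*} (op : X → X → X) (Φ : X → D)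
    (G : Set X) (e : X)
    (hG : ApproxGroup op Φ G e)
    (H₁ H₂ : Set X) (hH₁G : H₁ ⊆ G) (hH₂G : H₂ ⊆ G)
    (hH₁ : ApproxGroup op Φ H₁ e) (hH₂ : ApproxGroup op Φ H₂ e)
    (hgroupoid₁ : ∀ a ∈ upperApprox Φ H₁, ∀ b ∈ upperApprox Φ H₁,
      op a b ∈ upperApprox Φ H₁)
    (hgroupoid₂ : ∀ a ∈ upperApprox Φ H₂, ∀ b ∈ upperApprox Φ H₂,
      op a b ∈ upperApprox Φ H₂)
    (hinter : upperApprox Φ H₁ ∩ upperApprox Φ H₂ = upperApprox Φ (H₁ ∩ H₂))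
    (hne : (H₁ ∩ H₂).Nonempty) :
    ApproxGroup op Φ (H₁ ∩ H₂) e := by
  obtain ⟨-, assoc, ⟨-, ident⟩, -⟩ := hG
  refine ⟨fun x hx y hy => hinter ▸ ⟨hH₁.1 x hx.1 y hy.1, hH₂.1 x hx.2 y hy.2⟩,
    fun x hx y hy z hz => assoc x (hH₁G hx.1) y (hH₁G hy.1) z (hH₁G hz.1),
    ⟨hinter ▸ ⟨hH₁.2.2.1.1, hH₂.2.2.1.1⟩, fun x hx => ident x (hH₁G hx.1)⟩,
    fun x hx => ?_⟩
  obtain ⟨y, hy, hxy, hyx⟩ := hH₁.2.2.2 x hx.1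
  obtain ⟨z, hz, hxz, -⟩ := hH₂.2.2.2 x hx.2
  have hyz : y = z := by
    rw [← (ident y (hH₁G hy)).1, ← hxz, ← assoc y (hH₁G hy) x (hH₁G hx.1) z (hH₂G hz), hyx,
      (ident z (hH₂G hz)).2]
  exact ⟨y, ⟨hy, hyz ▸ hz⟩, hxy, hyx⟩
end
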